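/- For all integers p > q ≥ 1, the quantity â_{pq} = ∬_𝐐 L_p(ξ) L_q(η)/(2 − ξ − η) dξ dη admits the one-dimensional representation â_{pq} = ∫_{−1}^{1} ln((3−ξ)/(1−ξ)) · L_q(2−ξ) · L_p(ξ) dξ. -/

import Mathlib

noncomputable section

open Set MeasureTheory

/-- The reference square 𝐐 = (−1,1)². -/
def Qsq : Set (ℝ × ℝ) := Ioo (-1 : ℝ) 1 ×ˢ Ioo (-1 : ℝ) 1

/-- The Legendre polynomial of degree k, given by the Rodrigues formula
L_k(x) = 1/(2^k k!) d^k/dx^k (x²−1)^k. -/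
def legendre (k : ℕ) : Polynomial ℝ :=
  Polynomial.C (1 / (2 ^ k * (Nat.factorial k : ℝ))) *
    (Polynomial.derivative^[k] ((Polynomial.X ^ 2 - 1) ^ k))

/-- â_{pq} = ∬_𝐐 L_p(ξ) L_q(η)/(2 − ξ − η) dξ dη. -/
def ahat (p q : ℕ) : ℝ :=
  ∫ z in Qsq, (legendre p).eval z.1 * (legendre q).eval z.2 / (2 - z.1 - z.2)

lemma aux_orth (k : ℕ) : ∀ j ≤ k, ∀ S : Polynomial ℝ, S.degree < (j : ℕ) →
    ∫ x in (-1 : ℝ)..1, S.eval x *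
      (Polynomial.derivative^[j] ((Polynomial.X ^ 2 - 1 : Polynomial ℝ) ^ k)).eval x = 0 := by
  intro j
  induction j with
  | zero =>
    intro _ S hS
    have : S = 0 := by
      rw [← Polynomial.degree_eq_bot]
      exact Nat.WithBot.lt_zero_iff.mp (by simpa using hS)
    simp [this]
  | succ j ih =>
    intro hj S hS
    set F := Polynomial.derivative^[j] ((Polynomial.X ^ 2 - 1 : Polynomial ℝ) ^ k) with hF
    have hdvd : (Polynomial.X ^ 2 - 1 : Polynomial ℝ) ∣ F := by
      refine dvd_trans ?_ (Polynomial.pow_sub_dvd_iterate_derivative_pow _ k j)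
      exact dvd_pow_self _ (by omega)
    obtain ⟨G, hG⟩ := hdvd
    have h1 : F.eval 1 = 0 := by rw [hG]; simp
    have h2 : F.eval (-1) = 0 := by rw [hG]; simp
    rw [Function.iterate_succ_apply', ← hF]
    have hS' : S.derivative.degree < (j : ℕ) := by
      by_cases h0 : S.natDegree = 0
      · rw [Polynomial.natDegree_eq_zero] at h0
        obtain ⟨c, rfl⟩ := h0
        simp
      · have hS0 : S ≠ 0 := by rintro rfl; simp at h0
        have h3 : S.natDegree < j + 1 := (Polynomial.natDegree_lt_iff_degree_lt hS0).2 hS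
        have h4 := Polynomial.natDegree_derivative_lt h0
        refine lt_of_le_of_lt Polynomial.degree_le_natDegree ?_
        exact_mod_cast (by omega : S.derivative.natDegree < j)
    have hi := ih (by omega) _ hS'
    have := intervalIntegral.integral_mul_deriv_eq_deriv_mul (a := (-1:ℝ)) (b := 1)
      (u := fun x => S.eval x) (v := fun x => F.eval x)
      (u' := fun x => S.derivative.eval x) (v' := fun x => F.derivative.eval x)
      (fun x _ => S.hasDerivAt x) (fun x _ => F.hasDerivAt x)
      (S.derivative.continuous.intervalIntegrable _ _)
      (F.derivative.continuous.intervalIntegrable _ _)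
    rw [this, hi, h1, h2]
    simp

lemma legendre_orth (p : ℕ) (S : Polynomial ℝ) (hS : S.degree < (p : ℕ)) :
    ∫ x in (-1 : ℝ)..1, S.eval x * (legendre p).eval x = 0 := by
  have h := aux_orth p p le_rfl S hS
  unfold legendre
  simp only [Polynomial.eval_mul, Polynomial.eval_C, mul_left_comm]
  rw [intervalIntegral.integral_const_mul, h, mul_zero]

lemma slice_cont (ξ : ℝ) (hξ : ξ < 1) (f : ℝ → ℝ) (hf : Continuous f) :
    IntervalIntegrable (fun η => f η / (2 - ξ - η)) volume (-1) 1 := by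
  apply ContinuousOn.intervalIntegrable
  rw [uIcc_of_le (by norm_num)]
  refine hf.continuousOn.div (by fun_prop) ?_
  intro x hx
  have := hx.2
  linarith

lemma slice_one (ξ : ℝ) (hξ : ξ < 1) :
    ∫ η in (-1 : ℝ)..1, 1 / (2 - ξ - η) = Real.log ((3 - ξ) / (1 - ξ)) := by
  have h := intervalIntegral.integral_comp_sub_left (a := -1) (b := 1) (fun x : ℝ => 1 / x) (2 - ξ)
  rw [h, integral_one_div_of_pos (by linarith) (by linarith)]
  congr 2 <;> ring

lemma slice_pow (n : ℕ) : ∃ S : Polynomial ℝ, S ∈ Polynomial.degreeLT ℝ n ∧ ∀ ξ : ℝ, ξ < 1 →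
    ∫ η in (-1 : ℝ)..1, η ^ n / (2 - ξ - η) =
      (2 - ξ) ^ n * Real.log ((3 - ξ) / (1 - ξ)) - S.eval ξ := by
  induction n with
  | zero =>
    refine ⟨0, zero_mem _, fun ξ hξ => ?_⟩
    simpa using slice_one ξ hξ
  | succ n ih =>
    obtain ⟨S, hS, h⟩ := ih
    refine ⟨(Polynomial.C 2 - Polynomial.X) * S + Polynomial.C (∫ η in (-1:ℝ)..1, η ^ n), ?_,
      fun ξ hξ => ?_⟩
    · rw [Polynomial.mem_degreeLT] at hS
      apply add_mem
      · rw [Polynomial.mem_degreeLT]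
        by_cases h0 : S = 0
        · simp [h0]
        have h1 := (Polynomial.natDegree_lt_iff_degree_lt h0).2 hS
        have h2 : ((Polynomial.C 2 - Polynomial.X : Polynomial ℝ)).natDegree ≤ 1 := by compute_degree
        have h3 := Polynomial.natDegree_mul_le (p := (Polynomial.C 2 - Polynomial.X : Polynomial ℝ)) (q := S)
        refine lt_of_le_of_lt Polynomial.degree_le_natDegree ?_
        exact_mod_cast (by omega)
      · rw [Polynomial.mem_degreeLT]
        refine lt_of_le_of_lt Polynomial.degree_C_le ?_
        exact_mod_cast Nat.succ_pos n
    · have e : ∫ η in (-1 : ℝ)..1, η ^ (n+1) / (2 - ξ - η) =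
          ∫ η in (-1 : ℝ)..1, ((2 - ξ) * (η ^ n / (2 - ξ - η)) - η ^ n) := by
        apply intervalIntegral.integral_congr
        intro x hx
        rw [uIcc_of_le (by norm_num)] at hx
        have : 2 - ξ - x ≠ 0 := by have := hx.2; linarith
        simp only
        field_simp
        ring
      rw [e, intervalIntegral.integral_sub
        ((slice_cont ξ hξ _ (continuous_pow n)).const_mul _)
        ((continuous_pow n).intervalIntegrable _ _),
        intervalIntegral.integral_const_mul, h ξ hξ]
      simp only [Polynomial.eval_add, Polynomial.eval_mul, Polynomial.eval_sub,
        Polynomial.eval_C, Polynomial.eval_X]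
      ring

lemma slice_poly (P : Polynomial ℝ) : ∃ S : Polynomial ℝ,
    S ∈ Polynomial.degreeLT ℝ P.natDegree ∧ ∀ ξ : ℝ, ξ < 1 →
    ∫ η in (-1 : ℝ)..1, P.eval η / (2 - ξ - η) =
      P.eval (2 - ξ) * Real.log ((3 - ξ) / (1 - ξ)) - S.eval ξ := by
  choose S hS h using slice_pow
  refine ⟨∑ i ∈ Finset.range (P.natDegree + 1), P.coeff i • S i, ?_, fun ξ hξ => ?_⟩
  · refine sum_mem fun i hi => Submodule.smul_mem _ _ ?_
    exact Polynomial.degreeLT_mono (by simpa [Nat.lt_succ_iff] using hi) (hS i)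
  · simp only [Polynomial.eval_eq_sum_range (p := P), Finset.sum_div, mul_div_assoc]
    rw [intervalIntegral.integral_finsetSum]
    · simp only [intervalIntegral.integral_const_mul, h _ ξ hξ, Polynomial.eval_finsetSum,
        Polynomial.eval_smul, smul_eq_mul, Finset.sum_mul, ← Finset.sum_sub_distrib]
      exact Finset.sum_congr rfl fun i _ => by ring
    · intro i _
      exact (slice_cont ξ hξ _ (continuous_pow i)).const_mul _

lemma legendre_natDegree (k : ℕ) : (legendre k).natDegree ≤ k := by
  unfold legendre
  refine (Polynomial.natDegree_C_mul_le _ _).trans ?_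
  refine (Polynomial.natDegree_iterate_derivative _ _).trans ?_
  have : ((Polynomial.X ^ 2 - 1 : Polynomial ℝ) ^ k).natDegree ≤ k * 2 :=
    Polynomial.natDegree_pow_le_of_le k (by compute_degree)
  omega

lemma log_int : IntervalIntegrable (fun ξ : ℝ => Real.log ((3 - ξ) / (1 - ξ))) volume (-1) 1 := by
  have h1 : IntervalIntegrable (fun ξ : ℝ => Real.log (3 - ξ)) volume (-1) 1 := by
    have := (intervalIntegral.intervalIntegrable_log' (a := 4) (b := 2)).comp_sub_left 3
    norm_num at this
    exact this
  have h2 : IntervalIntegrable (fun ξ : ℝ => Real.log (1 - ξ)) volume (-1) 1 := by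
    have := (intervalIntegral.intervalIntegrable_log' (a := 2) (b := 0)).comp_sub_left 1
    norm_num at this
    exact this
  refine (h1.sub h2).congr_ae ?_
  rw [uIoc_of_le (by norm_num), ← restrict_Ioo_eq_restrict_Ioc]
  filter_upwards [ae_restrict_mem measurableSet_Ioo] with x hx
  have := hx.2
  rw [Real.log_div (by linarith) (by linarith)]

lemma vol_Qsq : (volume : Measure (ℝ × ℝ)).restrict Qsq =
    (volume.restrict (Ioo (-1 : ℝ) 1)).prod (volume.restrict (Ioo (-1 : ℝ) 1)) := by
  rw [Measure.prod_restrict]; rfl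

lemma kernel_int : Integrable (fun z : ℝ × ℝ => 1 / (2 - z.1 - z.2))
    ((volume.restrict (Ioo (-1 : ℝ) 1)).prod (volume.restrict (Ioo (-1 : ℝ) 1))) := by
  have hm : Measurable (fun z : ℝ × ℝ => 1 / (2 - z.1 - z.2)) := by fun_prop
  rw [integrable_prod_iff hm.aestronglyMeasurable]
  constructor
  · filter_upwards [ae_restrict_mem measurableSet_Ioo] with x hx
    have := slice_cont x hx.2 (fun _ => 1) continuous_const
    rw [intervalIntegrable_iff_integrableOn_Ioo_of_le (by norm_num)] at this
    exact this
  · have := log_int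
    rw [intervalIntegrable_iff_integrableOn_Ioo_of_le (by norm_num)] at this
    refine Integrable.congr this ?_
    filter_upwards [ae_restrict_mem measurableSet_Ioo] with x hx
    rw [← slice_one x hx.2, intervalIntegral.integral_of_le (by norm_num),
      ← integral_Ioc_eq_integral_Ioo]
    refine setIntegral_congr_fun measurableSet_Ioc ?_
    intro y hy
    have h1 := hx.2
    have h2 := hy.2
    have : 0 < 2 - x - y := by linarith
    simp only [Real.norm_eq_abs]
    rw [abs_of_pos (by positivity)]

lemma full_int (P Q : Polynomial ℝ) :
    Integrable (fun z : ℝ × ℝ => P.eval z.1 * Q.eval z.2 / (2 - z.1 - z.2))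
    ((volume.restrict (Ioo (-1 : ℝ) 1)).prod (volume.restrict (Ioo (-1 : ℝ) 1))) := by
  have hc : Continuous (fun z : ℝ × ℝ => P.eval z.1 * Q.eval z.2) :=
    (P.continuous.comp continuous_fst).mul (Q.continuous.comp continuous_snd)
  obtain ⟨C, hC⟩ := (isCompact_Icc (a := (-1:ℝ)) (b := 1)).prod
    (isCompact_Icc (a := (-1:ℝ)) (b := 1)) |>.exists_bound_of_continuousOn hc.continuousOn
  have := kernel_int.bdd_mul (c := C) hc.aestronglyMeasurable (by
    rw [← vol_Qsq]
    have hmQ : MeasurableSet Qsq := measurableSet_Ioo.prod measurableSet_Ioo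
    filter_upwards [ae_restrict_mem hmQ] with z hz
    exact hC z ⟨Ioo_subset_Icc_self hz.1, Ioo_subset_Icc_self hz.2⟩)
  simpa only [mul_one_div] using this

/-- One-dimensional representation: for p > q ≥ 1,
â_{pq} = ∫_{−1}^{1} ln((3−ξ)/(1−ξ)) L_q(2−ξ) L_p(ξ) dξ. -/
theorem ahat_one_dim (p q : ℕ) (hq : 1 ≤ q) (hpq : q < p) :
    ahat p q =
      ∫ ξ in (-1 : ℝ)..1,
        Real.log ((3 - ξ) / (1 - ξ)) * (legendre q).eval (2 - ξ) *
          (legendre p).eval ξ := by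
  obtain ⟨S, hS, h⟩ := slice_poly (legendre q)
  have hS' : S.degree < (p : ℕ) := by
    rw [Polynomial.mem_degreeLT] at hS
    refine hS.trans_le ?_
    exact_mod_cast (legendre_natDegree q).trans hpq.le
  have ho := legendre_orth p S hS'
  have hli : IntervalIntegrable (fun ξ : ℝ => Real.log ((3 - ξ) / (1 - ξ)) *
      (legendre q).eval (2 - ξ) * (legendre p).eval ξ) volume (-1) 1 := by
    refine (log_int.mul_continuousOn ?_).mul_continuousOn (legendre p).continuous.continuousOn
    exact ((legendre q).continuous.comp (continuous_const.sub continuous_id)).continuousOn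
  have hsi : IntervalIntegrable (fun ξ : ℝ => S.eval ξ * (legendre p).eval ξ) volume (-1) 1 :=
    (S.continuous.mul (legendre p).continuous).intervalIntegrable _ _
  rw [← sub_zero (∫ ξ in (-1 : ℝ)..1, Real.log ((3 - ξ) / (1 - ξ)) *
      (legendre q).eval (2 - ξ) * (legendre p).eval ξ), ← ho,
    ← intervalIntegral.integral_sub hli hsi]
  unfold ahat
  rw [vol_Qsq, integral_prod _ (full_int _ _), intervalIntegral.integral_of_le (by norm_num),
    integral_Ioc_eq_integral_Ioo]
  refine setIntegral_congr_fun measurableSet_Ioo ?_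
  intro x hx
  have hx' := h x hx.2
  rw [intervalIntegral.integral_of_le (by norm_num), integral_Ioc_eq_integral_Ioo] at hx'
  simp only [mul_div_assoc]
  rw [integral_const_mul, hx']
  ring
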